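/- Let 𝔅' ⊆ 𝔅(X) be nonempty with the forward exchange property, suppose X contains an element that is neither a loop nor a coloop, and let x be the first such element (smallest index). Assume 𝔅'_{∖x} := {B ∈ 𝔅' : x ∉ B} and 𝔅'_{|x} := {B ∈ 𝔅' : x ∈ B} are both nonempty, and set 𝔅'_{/x} := {π_x(B∖x) : B ∈ 𝔅'_{|x}}. Then the sequence 0 → 𝒟(X/x, 𝔅'_{/x}) → 𝒟(X,𝔅') → 𝒟(X∖x, 𝔅'_{∖x}) → 0 is exact, where the first map is the inclusion j_x and the second is the directional derivative D_x: j_x(𝒟(X/x,𝔅'_{/x})) ⊆ 𝒟(X,𝔅'), D_x maps 𝒟(X,𝔅') onto 𝒟(X∖x,𝔅'_{∖x}), and {f ∈ 𝒟(X,𝔅') : D_x f = 0} = j_x(𝒟(X/x,𝔅'_{/x})). -/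

import Mathlib

noncomputable section

variable {r N : ℕ}

/-- `p_u`, the degree-one polynomial associated with the vector `u ∈ ℝ^r`. -/
def linPoly {r : ℕ} (u : Fin r → ℝ) : MvPolynomial (Fin r) ℝ :=
  ∑ i, MvPolynomial.C (u i) * MvPolynomial.X i

/-- `p_Y = ∏_{i ∈ Y} p_{X i}` for a sublist `Y` of the list `X`. -/
def prodPoly {r N : ℕ} (X : Fin N → Fin r → ℝ) (Y : Finset (Fin N)) : MvPolynomial (Fin r) ℝ :=
  ∏ i ∈ Y, linPoly (X i)

/-- The pairing `⟨p, f⟩ = (p(∂/∂t₁,…,∂/∂t_r) f)(0)`, written via coefficients: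
`⟨p,f⟩ = ∑_α α! · p_α · f_α`. -/
def pairing {r : ℕ} (p f : MvPolynomial (Fin r) ℝ) : ℝ :=
  ∑ α ∈ p.support, (∏ i, ((α i).factorial : ℝ)) * p.coeff α * f.coeff α

lemma pairing_zero {r : ℕ} (q : MvPolynomial (Fin r) ℝ) : pairing q 0 = 0 := by
  simp [pairing]

lemma pairing_add {r : ℕ} (q f g : MvPolynomial (Fin r) ℝ) :
    pairing q (f + g) = pairing q f + pairing q g := by
  unfold pairing
  rw [← Finset.sum_add_distrib]
  exact Finset.sum_congr rfl fun α _ => by rw [MvPolynomial.coeff_add]; ring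

lemma pairing_smul {r : ℕ} (q : MvPolynomial (Fin r) ℝ) (c : ℝ) (f : MvPolynomial (Fin r) ℝ) :
    pairing q (c • f) = c * pairing q f := by
  unfold pairing
  rw [Finset.mul_sum]
  exact Finset.sum_congr rfl fun α _ => by rw [MvPolynomial.coeff_smul, smul_eq_mul]; ring

/-- The kernel (Macaulay inverse system) of an ideal `I`:
all polynomials annihilated (in the sense of the pairing) by every element of `I`. -/
def kerIdeal {r : ℕ} (I : Ideal (MvPolynomial (Fin r) ℝ)) :
    Submodule ℝ (MvPolynomial (Fin r) ℝ) where
  carrier := {f | ∀ q ∈ I, pairing q f = 0}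
  add_mem' := fun hf hg q hq => by
    rw [pairing_add, hf q hq, hg q hq, add_zero]
  zero_mem' := fun q _ => pairing_zero q
  smul_mem' := fun c f hf q hq => by
    rw [pairing_smul, hf q hq, mul_zero]

section Lists

variable {M : Type*} [AddCommGroup M] [Module ℝ M]

/-- `B ⊆ G` is (the index set of) a sublist of the list `v` restricted to the ground set `G`
that is a basis of the ambient space. -/
def basesOn (v : Fin N → M) (G : Finset (Fin N)) : Set (Finset (Fin N)) :=
  {B | B ⊆ G ∧ LinearIndependent ℝ ((B : Set (Fin N)).restrict v) ∧
    Submodule.span ℝ (v '' (B : Set (Fin N))) = ⊤}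

/-- `j` is externally active with respect to the basis `B`:
`v j ∈ span {v e : e ∈ B, e ≤ j}` and `j ∉ B`. -/
def isExtActive (v : Fin N → M) (B : Finset (Fin N)) (j : Fin N) : Prop :=
  j ∉ B ∧ v j ∈ Submodule.span ℝ (v '' {e : Fin N | e ∈ B ∧ e ≤ j})

open Classical in
/-- The set `E(B)` of externally active elements (within the ground set `G`). -/
def extSetOn (v : Fin N → M) (G B : Finset (Fin N)) : Finset (Fin N) :=
  G.filter (fun j => isExtActive v B j)

/-- `C` is a cocircuit w.r.t. the collection of bases `𝔅`: an inclusion-minimal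
sublist of the ground set `G` intersecting every basis in `𝔅`. -/
def isCocircuitOn (G : Finset (Fin N)) (𝔅 : Set (Finset (Fin N))) (C : Finset (Fin N)) : Prop :=
  C ⊆ G ∧ (∀ B ∈ 𝔅, (C ∩ B).Nonempty) ∧
    ∀ C' ⊆ C, (∀ B ∈ 𝔅, (C' ∩ B).Nonempty) → C' = C

/-- A set of bases `𝔅` of the list `v` has the forward exchange property. -/
def forwardExchange (v : Fin N → M) (𝔅 : Set (Finset (Fin N))) : Prop :=
  ∀ B ∈ 𝔅, ∀ b ∈ B, ∀ j : Fin N,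
    v j ∈ Submodule.span ℝ (v '' {e : Fin N | e ∈ B ∧ e ≤ b}) →
    v j ∉ Submodule.span ℝ (v '' {e : Fin N | e ∈ B ∧ e < b}) →
    ¬ isExtActive v B j →
    insert j (B.erase b) ∈ 𝔅

end Lists

/-- The ideal `𝒥` generated by the cocircuit polynomials `p_C`. -/
def Jideal (X : Fin N → Fin r → ℝ) (G : Finset (Fin N)) (𝔅 : Set (Finset (Fin N))) :
    Ideal (MvPolynomial (Fin r) ℝ) :=
  Ideal.span {p | ∃ C : Finset (Fin N), isCocircuitOn G 𝔅 C ∧ p = prodPoly X C}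

/-- The generalised `𝒟`-space: the kernel of the cocircuit ideal. -/
def Dspace (X : Fin N → Fin r → ℝ) (G : Finset (Fin N)) (𝔅 : Set (Finset (Fin N))) :
    Submodule ℝ (MvPolynomial (Fin r) ℝ) :=
  kerIdeal (Jideal X G 𝔅)

/-- `Q_B := p_{X∖(B ∪ E(B))}` (within the ground set `G`). -/
def QB (X : Fin N → Fin r → ℝ) (G B : Finset (Fin N)) : MvPolynomial (Fin r) ℝ :=
  prodPoly X (G \ (B ∪ extSetOn X G B))

/-- The central `𝒫`-space: the span of `p_Y` over sublists `Y` of `G` whose complement spans. -/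
def PspaceOn (X : Fin N → Fin r → ℝ) (G : Finset (Fin N)) :
    Submodule ℝ (MvPolynomial (Fin r) ℝ) :=
  Submodule.span ℝ {p | ∃ Y : Finset (Fin N), Y ⊆ G ∧
    Submodule.span ℝ (X '' ((G \ Y : Finset (Fin N)) : Set (Fin N))) = ⊤ ∧ p = prodPoly X Y}

/-- The generalised `𝒫`-space `𝒫(X,𝔅') = span {Q_B : B ∈ 𝔅'}`. -/
def PspaceB (X : Fin N → Fin r → ℝ) (G : Finset (Fin N)) (𝔅 : Set (Finset (Fin N))) :
    Submodule ℝ (MvPolynomial (Fin r) ℝ) :=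
  Submodule.span ℝ {p | ∃ B ∈ 𝔅, p = QB X G B}

/-- The directional derivative `D_u = ∑ i, uᵢ ∂/∂tᵢ` as a linear map. -/
def dirDeriv {r : ℕ} (u : Fin r → ℝ) :
    MvPolynomial (Fin r) ℝ →ₗ[ℝ] MvPolynomial (Fin r) ℝ :=
  ∑ i, u i • (MvPolynomial.pderiv i).toLinearMap

end

/-- `𝒟(X/x, 𝔅'_{/x})`, realised inside `ℝ[t₁,…,t_r]` via the identification of
`Sym((ℝ^r/ℝx)^*)` with the subalgebra `{f : D_x f = 0}`: the polynomials `f` with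
`D_x f = 0` annihilated by the ideal generated by the `𝔅'_{/x}`-cocircuit
polynomials (taken as the lifts `p_C`, which act correctly on such `f`). -/
noncomputable def DspaceContrB {r N : ℕ} (X : Fin N → Fin r → ℝ) (i0 : Fin N)
    (𝔅' : Set (Finset (Fin N))) : Submodule ℝ (MvPolynomial (Fin r) ℝ) :=
  Dspace X (Finset.univ.erase i0) {C | ∃ B ∈ 𝔅', i0 ∈ B ∧ C = B.erase i0} ⊓
    LinearMap.ker (dirDeriv (X i0))

section Polynomials

open MvPolynomial

variable {r : ℕ}

lemma dirDeriv_apply (u : Fin r → ℝ) (f : MvPolynomial (Fin r) ℝ) :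
    dirDeriv u f = ∑ i, u i • pderiv i f := by
  simp [dirDeriv]

lemma coeff_dirDeriv (u : Fin r → ℝ) (f : MvPolynomial (Fin r) ℝ) (α : Fin r →₀ ℕ) :
    coeff α (dirDeriv u f) =
      ∑ i, u i * (coeff (α + Finsupp.single i 1) f * ((α i : ℝ) + 1)) := by
  simp [dirDeriv_apply, coeff_sum, coeff_pderiv]

lemma dirDeriv_mul (u : Fin r → ℝ) (f g : MvPolynomial (Fin r) ℝ) :
    dirDeriv u (f * g) = dirDeriv u f * g + f * dirDeriv u g := by
  simp only [dirDeriv_apply, pderiv_mul, Finset.sum_mul, Finset.mul_sum,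
    ← Finset.sum_add_distrib, smul_add, smul_mul_assoc, mul_smul_comm]

lemma dirDeriv_linPoly (u w : Fin r → ℝ) :
    dirDeriv u (linPoly w) = C (∑ i, u i * w i) := by
  simp [dirDeriv_apply, linPoly, pderiv_X, Pi.single_apply, smul_eq_C_mul]

lemma dirDeriv_comm (u w : Fin r → ℝ) (f : MvPolynomial (Fin r) ℝ) :
    dirDeriv u (dirDeriv w f) = dirDeriv w (dirDeriv u f) := by
  ext α
  simp only [coeff_dirDeriv, Finset.mul_sum, Finset.sum_mul]
  rw [Finset.sum_comm]
  refine Finset.sum_congr rfl fun i _ => Finset.sum_congr rfl fun j _ => ?_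
  rw [add_right_comm]
  rcases eq_or_ne i j with rfl | h
  · ring
  · simp [Finsupp.single_eq_of_ne h, Finsupp.single_eq_of_ne h.symm]
    ring

/-- An antiderivative in direction `x` of `t ^ m * f`, where `t` is a linear form with
`D_x t = 1`, which is killed by all directional derivatives killing `t` and `f`. -/
lemma exists_dirDeriv_eq_pow_mul {L : Set (Fin r → ℝ)} {x : Fin r → ℝ}
    {t : MvPolynomial (Fin r) ℝ} (htx : dirDeriv x t = 1) (htL : ∀ l ∈ L, dirDeriv l t = 0)
    (n : ℕ) :
    ∀ (m : ℕ) (f : MvPolynomial (Fin r) ℝ), (∀ α, n ≤ Finsupp.degree α → coeff α f = 0) →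
      (∀ l ∈ L, dirDeriv l f = 0) →
      ∃ h, (∀ l ∈ L, dirDeriv l h = 0) ∧ dirDeriv x h = t ^ m * f := by
  have hC : ∀ (u : Fin r → ℝ) (c : ℝ), dirDeriv u (C c) = 0 := by simp [dirDeriv_apply]
  have hpow : ∀ (u : Fin r → ℝ) (m : ℕ),
      dirDeriv u (t ^ (m + 1)) = C ((m : ℝ) + 1) * t ^ m * dirDeriv u t := by
    intro u m
    induction m with
    | zero => simp
    | succ m ih =>
      rw [pow_succ, dirDeriv_mul, ih]
      push_cast
      simp only [map_add, map_one]
      ring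
  induction n with
  | zero =>
    intro m f hf _
    have : f = 0 := by ext α; simpa using hf α (Nat.zero_le _)
    exact ⟨0, by simp, by simp [this]⟩
  | succ n ih =>
    intro m f hf hL
    obtain ⟨h, hhL, hhx⟩ := ih (m + 1) (dirDeriv x f) (by
      intro α hα
      rw [coeff_dirDeriv]
      refine Finset.sum_eq_zero fun i _ => ?_
      rw [hf _ (by simpa [map_add] using hα)]
      ring) (fun l hl => by rw [dirDeriv_comm, hL l hl, map_zero])
    have hm : (m : ℝ) + 1 ≠ 0 := by positivity
    refine ⟨C ((m : ℝ) + 1)⁻¹ * (t ^ (m + 1) * f - h), fun l hl => ?_, ?_⟩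
    · rw [dirDeriv_mul, hC, map_sub, dirDeriv_mul, hpow, htL l hl, hL l hl, hhL l hl]
      simp
    · rw [dirDeriv_mul, hC, map_sub, dirDeriv_mul, hpow, htx, hhx]
      have : (C ((m : ℝ) + 1)⁻¹ * C ((m : ℝ) + 1) : MvPolynomial (Fin r) ℝ) = 1 := by
        rw [← C_mul, inv_mul_cancel₀ hm, C_1]
      linear_combination (t ^ m * f) * this

lemma exists_dirDeriv_eq {L : Set (Fin r → ℝ)} {x : Fin r → ℝ}
    (hx : x ∉ Submodule.span ℝ L) {g : MvPolynomial (Fin r) ℝ}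
    (hg : ∀ l ∈ L, dirDeriv l g = 0) :
    ∃ f, (∀ l ∈ L, dirDeriv l f = 0) ∧ dirDeriv x f = g := by
  obtain ⟨φ, hφx, hφL⟩ := Submodule.exists_le_ker_of_notMem hx
  have key : ∀ u, dirDeriv u (linPoly fun i => (φ x)⁻¹ * φ (Pi.single i 1)) =
      C ((φ x)⁻¹ * φ u) := by
    intro u
    rw [dirDeriv_linPoly]
    congr 1
    conv_rhs => rw [LinearMap.pi_apply_eq_sum_univ φ u, Finset.mul_sum]
    refine Finset.sum_congr rfl fun i _ => ?_
    have : (fun j => if i = j then (1 : ℝ) else 0) = Pi.single i 1 := by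
      ext j; simp [Pi.single_apply, eq_comm]
    rw [this, smul_eq_mul]
    ring
  obtain ⟨h, hL, hh⟩ := exists_dirDeriv_eq_pow_mul (L := L) (x := x)
    (by rw [key, inv_mul_cancel₀ hφx, C_1])
    (fun l hl => by
      have : φ l = 0 := hφL (Submodule.subset_span hl)
      rw [key, this, mul_zero, C_0]) (g.totalDegree + 1) 0 g
    (fun α hα => coeff_eq_zero_of_totalDegree_lt (Nat.lt_of_succ_le hα)) hg
  exact ⟨h, hL, by simpa using hh⟩

lemma pairing_eq_sum {s : Finset (Fin r →₀ ℕ)} {p : MvPolynomial (Fin r) ℝ} (hs : p.support ⊆ s)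
    (f : MvPolynomial (Fin r) ℝ) :
    pairing p f = ∑ α ∈ s, (∏ i, ((α i).factorial : ℝ)) * p.coeff α * f.coeff α := by
  refine Finset.sum_subset hs fun α _ hα => ?_
  rw [notMem_support_iff.1 hα]
  ring

lemma pairing_add_left (p q f : MvPolynomial (Fin r) ℝ) :
    pairing (p + q) f = pairing p f + pairing q f := by
  classical
  rw [pairing_eq_sum (support_add (p := p) (q := q)),
    pairing_eq_sum (Finset.subset_union_left (s₂ := q.support)),
    pairing_eq_sum (Finset.subset_union_right (s₁ := p.support)), ← Finset.sum_add_distrib]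
  exact Finset.sum_congr rfl fun α _ => by rw [coeff_add]; ring

lemma pairing_zero_left (f : MvPolynomial (Fin r) ℝ) : pairing 0 f = 0 := by
  simp [pairing]

lemma pairing_monomial (α : Fin r →₀ ℕ) (a : ℝ) (f : MvPolynomial (Fin r) ℝ) :
    pairing (monomial α a) f = (∏ i, ((α i).factorial : ℝ)) * a * f.coeff α := by
  rw [pairing_eq_sum support_monomial_subset]
  simp

lemma pairing_sum_left {ι : Type*} (s : Finset ι) (p : ι → MvPolynomial (Fin r) ℝ)
    (f : MvPolynomial (Fin r) ℝ) : pairing (∑ i ∈ s, p i) f = ∑ i ∈ s, pairing (p i) f := by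
  classical
  induction s using Finset.induction_on with
  | empty => simp [pairing_zero_left]
  | insert a s ha ih => rw [Finset.sum_insert ha, Finset.sum_insert ha, pairing_add_left, ih]

/-- Multiplication by `p_u` is adjoint to `D_u`. -/
lemma pairing_linPoly_mul (u : Fin r → ℝ) (p f : MvPolynomial (Fin r) ℝ) :
    pairing (linPoly u * p) f = pairing p (dirDeriv u f) := by
  induction p using MvPolynomial.induction_on' with
  | add p q hp hq => rw [mul_add, pairing_add_left, pairing_add_left, hp, hq]
  | monomial α a =>
    rw [linPoly, Finset.sum_mul, pairing_sum_left, pairing_monomial, coeff_dirDeriv,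
      Finset.mul_sum]
    refine Finset.sum_congr rfl fun i _ => ?_
    rw [X, C_mul_monomial, monomial_mul, pairing_monomial, add_comm (Finsupp.single i 1)]
    have : (∏ j, (((α + Finsupp.single i 1 : Fin r →₀ ℕ) j).factorial : ℝ)) =
        ((α i : ℝ) + 1) * ∏ j, ((α j).factorial : ℝ) := by
      rw [← Finset.mul_prod_erase _ _ (Finset.mem_univ i),
        ← Finset.mul_prod_erase _ (fun j => ((α j).factorial : ℝ)) (Finset.mem_univ i), ← mul_assoc]
      congr 1
      · simp [Nat.factorial_succ]
      · refine Finset.prod_congr rfl fun j hj => ?_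
        simp [Finsupp.single_eq_of_ne (Finset.ne_of_mem_erase hj)]
    rw [this]
    ring

lemma eq_zero_of_pairing {f : MvPolynomial (Fin r) ℝ} (h : ∀ q, pairing q f = 0) : f = 0 := by
  ext α
  have := h (monomial α 1)
  rw [pairing_monomial, mul_one, mul_eq_zero] at this
  refine this.resolve_left ?_
  positivity

end Polynomials

section Annihilators

variable {r N : ℕ}

/-- `C` intersects every member of `𝔅`. -/
def IsTransversal (𝔅 : Set (Finset (Fin N))) (C : Finset (Fin N)) : Prop :=
  ∀ B ∈ 𝔅, (C ∩ B).Nonempty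

/-- The polynomials annihilated by `p(∂)`. -/
noncomputable def annihilatedBy (p : MvPolynomial (Fin r) ℝ) : Submodule ℝ (MvPolynomial (Fin r) ℝ) :=
  kerIdeal (Ideal.span {p})

lemma mem_annihilatedBy {p f : MvPolynomial (Fin r) ℝ} :
    f ∈ annihilatedBy p ↔ ∀ q, pairing (q * p) f = 0 := by
  change (∀ q ∈ Ideal.span {p}, pairing q f = 0) ↔ _
  simp only [Ideal.mem_span_singleton']
  exact ⟨fun h q => h _ ⟨q, rfl⟩, fun h _ ⟨q, hq⟩ => hq ▸ h q⟩

lemma mem_annihilatedBy_of_dvd {p p' f : MvPolynomial (Fin r) ℝ} (hp : p ∣ p')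
    (hf : f ∈ annihilatedBy p) : f ∈ annihilatedBy p' := by
  obtain ⟨a, rfl⟩ := hp
  rw [mem_annihilatedBy] at hf ⊢
  intro q
  rw [mul_comm p, ← mul_assoc]
  exact hf _

lemma mem_annihilatedBy_linPoly_mul {u : Fin r → ℝ} {p f : MvPolynomial (Fin r) ℝ} :
    f ∈ annihilatedBy (linPoly u * p) ↔ dirDeriv u f ∈ annihilatedBy p := by
  simp only [mem_annihilatedBy]
  refine forall_congr' fun q => ?_
  rw [← pairing_linPoly_mul, mul_left_comm]

lemma dirDeriv_mem_annihilatedBy {p f : MvPolynomial (Fin r) ℝ} (u : Fin r → ℝ)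
    (hf : f ∈ annihilatedBy p) : dirDeriv u f ∈ annihilatedBy p :=
  mem_annihilatedBy_linPoly_mul.1 (mem_annihilatedBy_of_dvd (Dvd.intro_left _ rfl) hf)

/-- The polynomials annihilated by the products over all transversals of `𝔅`
and by the derivatives in the directions in `L`. -/
noncomputable def transversalKer (X : Fin N → Fin r → ℝ) (𝔅 : Set (Finset (Fin N)))
    (L : Set (Fin r → ℝ)) : Submodule ℝ (MvPolynomial (Fin r) ℝ) :=
  (⨅ (C : Finset (Fin N)) (_ : IsTransversal 𝔅 C), annihilatedBy (prodPoly X C)) ⊓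
    ⨅ l ∈ L, LinearMap.ker (dirDeriv l)

variable {X : Fin N → Fin r → ℝ} {𝔅 : Set (Finset (Fin N))} {L : Set (Fin r → ℝ)}
  {f : MvPolynomial (Fin r) ℝ}

lemma mem_transversalKer : f ∈ transversalKer X 𝔅 L ↔
    (∀ C, IsTransversal 𝔅 C → f ∈ annihilatedBy (prodPoly X C)) ∧ ∀ l ∈ L, dirDeriv l f = 0 := by
  simp [transversalKer, Submodule.mem_iInf]

lemma Dspace_eq_transversalKer {G : Finset (Fin N)} (hG : ∀ B ∈ 𝔅, B ⊆ G) :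
    Dspace X G 𝔅 = transversalKer X 𝔅 ∅ := by
  ext f
  simp only [mem_transversalKer, Set.mem_empty_iff_false, false_imp_iff, implies_true, and_true]
  change (∀ q ∈ Jideal X G 𝔅, pairing q f = 0) ↔ _
  constructor
  · intro h C hC
    have hCG : IsTransversal 𝔅 (C ∩ G) := fun B hB => by
      obtain ⟨a, ha⟩ := hC B hB
      rw [Finset.mem_inter] at ha
      exact ⟨a, by simp [ha, hG B hB ha.2]⟩
    obtain ⟨D, hDC, hD⟩ := exists_minimal_le_of_wellFoundedLT (IsTransversal 𝔅) _ hCG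
    have hDcoc : isCocircuitOn G 𝔅 D :=
      ⟨hDC.trans Finset.inter_subset_right, hD.prop,
        fun C' hC' hC'T => hD.eq_of_le hC'T hC'⟩
    refine mem_annihilatedBy_of_dvd
      (Finset.prod_dvd_prod_of_subset D C _ (hDC.trans Finset.inter_subset_left)) ?_
    exact mem_annihilatedBy.2 fun q =>
      h _ (Ideal.mul_mem_left _ _ (Ideal.subset_span ⟨D, hDcoc, rfl⟩))
  · intro h q hq
    suffices f ∈ annihilatedBy q by simpa using mem_annihilatedBy.1 this 1
    refine Submodule.span_induction (p := fun q _ => f ∈ annihilatedBy q) ?_ ?_ ?_ ?_ hq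
    · rintro _ ⟨C, hC, rfl⟩
      exact h C hC.2.1
    · simp [mem_annihilatedBy, pairing_zero_left]
    · intro p q _ _ hp hq
      rw [mem_annihilatedBy] at *
      intro a
      rw [mul_add, pairing_add_left, hp, hq, add_zero]
    · intro a p _ hp
      exact mem_annihilatedBy_of_dvd (Dvd.intro_left a rfl) hp

lemma dirDeriv_mem_transversalKer (u : Fin r → ℝ) (hf : f ∈ transversalKer X 𝔅 L) :
    dirDeriv u f ∈ transversalKer X 𝔅 L := by
  rw [mem_transversalKer] at *
  exact ⟨fun C hC => dirDeriv_mem_annihilatedBy u (hf.1 C hC),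
    fun l hl => by rw [dirDeriv_comm, hf.2 l hl, map_zero]⟩

/-- The members of `𝔅` avoiding `y`. -/
def deletion (𝔅 : Set (Finset (Fin N))) (y : Fin N) : Set (Finset (Fin N)) :=
  {B ∈ 𝔅 | y ∉ B}

/-- The members of `𝔅` containing `y`, with `y` removed. -/
def contraction (𝔅 : Set (Finset (Fin N))) (y : Fin N) : Set (Finset (Fin N)) :=
  {C | ∃ B ∈ 𝔅, y ∈ B ∧ C = B.erase y}

/-- Every member of `𝔅` avoiding `y` contains, up to `y`, a member of `𝔅` through `y`. -/
def IsShedding (𝔅 : Set (Finset (Fin N))) (y : Fin N) : Prop :=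
  ∀ B ∈ 𝔅, y ∉ B → ∃ B' ∈ 𝔅, y ∈ B' ∧ B'.erase y ⊆ B

variable {y : Fin N}

lemma IsTransversal.of_contraction {C : Finset (Fin N)} (hy : IsShedding 𝔅 y)
    (hC : IsTransversal (contraction 𝔅 y) C) : IsTransversal 𝔅 C := by
  intro B hB
  by_cases hyB : y ∈ B
  · exact (hC _ ⟨B, hB, hyB, rfl⟩).mono
      (Finset.inter_subset_inter_left (Finset.erase_subset _ _))
  · obtain ⟨B', hB', hyB', hsub⟩ := hy B hB hyB
    exact (hC _ ⟨B', hB', hyB', rfl⟩).mono (Finset.inter_subset_inter_left hsub)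

lemma IsTransversal.contraction {C : Finset (Fin N)} (hC : IsTransversal 𝔅 C) (hy : y ∉ C) :
    IsTransversal (contraction 𝔅 y) C := by
  rintro _ ⟨B, hB, -, rfl⟩
  obtain ⟨a, ha⟩ := hC B hB
  rw [Finset.mem_inter] at ha
  exact ⟨a, Finset.mem_inter.2
    ⟨ha.1, Finset.mem_erase.2 ⟨fun h => hy (h ▸ ha.1), ha.2⟩⟩⟩

lemma IsTransversal.deletion {C : Finset (Fin N)} (hC : IsTransversal 𝔅 C) :
    IsTransversal (deletion 𝔅 y) C := fun B hB => hC B hB.1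

lemma prodPoly_eq_linPoly_mul {C : Finset (Fin N)} (hy : y ∈ C) :
    prodPoly X C = linPoly (X y) * prodPoly X (C.erase y) :=
  (Finset.mul_prod_erase _ _ hy).symm

lemma transversalKer_le_contraction (hy : IsShedding 𝔅 y) :
    transversalKer X 𝔅 L ≤ transversalKer X (contraction 𝔅 y) L := fun f hf => by
  rw [mem_transversalKer] at *
  exact ⟨fun C hC => hf.1 C (hC.of_contraction hy), hf.2⟩

lemma transversalKer_deletion_le_contraction (hy : IsShedding 𝔅 y) :
    transversalKer X (deletion 𝔅 y) L ≤ transversalKer X (contraction 𝔅 y) L := fun f hf => by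
  rw [mem_transversalKer] at *
  exact ⟨fun C hC => hf.1 C (hC.of_contraction hy).deletion, hf.2⟩

lemma dirDeriv_mem_transversalKer_deletion (hf : f ∈ transversalKer X 𝔅 L) :
    dirDeriv (X y) f ∈ transversalKer X (deletion 𝔅 y) L := by
  have hf' := mem_transversalKer.1 (dirDeriv_mem_transversalKer (X y) hf)
  rw [mem_transversalKer] at *
  refine ⟨fun C hC => ?_, hf'.2⟩
  have hT : IsTransversal 𝔅 (insert y C) := fun B hB => by
    by_cases hyB : y ∈ B
    · exact ⟨y, by simp [hyB]⟩
    · exact (hC B ⟨hB, hyB⟩).mono (Finset.inter_subset_inter_right (Finset.subset_insert _ _))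
  by_cases hyC : y ∈ C
  · rw [Finset.insert_eq_of_mem hyC] at hT
    exact hf'.1 C hT
  · have := hf.1 _ hT
    rwa [prodPoly_eq_linPoly_mul (Finset.mem_insert_self y C), Finset.erase_insert hyC,
      mem_annihilatedBy_linPoly_mul] at this

lemma mem_transversalKer_of_dirDeriv_mem (hf : f ∈ transversalKer X (contraction 𝔅 y) L)
    (hd : dirDeriv (X y) f ∈ transversalKer X (deletion 𝔅 y) L) : f ∈ transversalKer X 𝔅 L := by
  rw [mem_transversalKer] at *
  refine ⟨fun C hC => ?_, hf.2⟩
  by_cases hyC : y ∈ C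
  · rw [prodPoly_eq_linPoly_mul hyC, mem_annihilatedBy_linPoly_mul]
    refine hd.1 _ fun B hB => ?_
    obtain ⟨a, ha⟩ := hC B hB.1
    rw [Finset.mem_inter] at ha
    exact ⟨a, Finset.mem_inter.2
      ⟨Finset.mem_erase.2 ⟨fun h => hB.2 (h ▸ ha.2), ha.1⟩, ha.2⟩⟩
  · exact hf.1 C (hC.contraction hyC)

/-- Families that reduce to subfamilies of `{∅}` by repeatedly splitting off shedding elements
(vertex decomposability of the complex of complements). -/
inductive Decomposable : Set (Finset (Fin N)) → Prop
  | leaf {𝔅 : Set (Finset (Fin N))} : 𝔅 ⊆ {∅} → Decomposable 𝔅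
  | shed {𝔅 : Set (Finset (Fin N))} (y : Fin N) : IsShedding 𝔅 y →
      Decomposable (deletion 𝔅 y) → Decomposable (contraction 𝔅 y) → Decomposable 𝔅

/-- `D_x` is surjective on `transversalKer X 𝔅 L` if `𝔅` is decomposable and its members are
independent modulo `L` with `x` outside their span modulo `L`. -/
theorem Decomposable.exists_dirDeriv_eq (h : Decomposable 𝔅) :
    ∀ (L : Set (Fin r → ℝ)) (x : Fin r → ℝ),
      (∀ B ∈ 𝔅, x ∉ Submodule.span ℝ (L ∪ X '' (B : Set (Fin N)))) →
      (∀ B ∈ 𝔅, ∀ b ∈ B,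
        X b ∉ Submodule.span ℝ (L ∪ X '' ((B.erase b : Finset (Fin N)) : Set (Fin N)))) →
      ∀ g ∈ transversalKer X 𝔅 L, ∃ f ∈ transversalKer X 𝔅 L, dirDeriv x f = g := by
  induction h with
  | @leaf 𝔅 h𝔅 =>
    intro L x hx _ g hg
    by_cases hempty : ∅ ∈ 𝔅
    · obtain ⟨f, hfL, hf⟩ := _root_.exists_dirDeriv_eq (by simpa using hx ∅ hempty)
        (mem_transversalKer.1 hg).2
      refine ⟨f, mem_transversalKer.2 ⟨fun C hC => ?_, hfL⟩, hf⟩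
      simpa using hC ∅ hempty
    · have hT : IsTransversal 𝔅 ∅ := fun B hB => absurd (h𝔅 hB ▸ hB) hempty
      have := mem_annihilatedBy.1 ((mem_transversalKer.1 hg).1 ∅ hT)
      have hg0 : g = 0 := eq_zero_of_pairing fun q => by simpa [prodPoly] using this q
      exact ⟨0, zero_mem _, by rw [hg0, map_zero]⟩
  | @shed 𝔅 y hy _ _ ihd ihc =>
    intro L x hx hind g hg
    have hmono : ∀ (B B' : Finset (Fin N)), B ⊆ B' →
        Submodule.span ℝ (L ∪ X '' (B : Set (Fin N))) ≤
          Submodule.span ℝ (L ∪ X '' (B' : Set (Fin N))) := fun B B' h =>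
      Submodule.span_mono (Set.union_subset_union_right _
        (Set.image_mono (Finset.coe_subset.2 h)))
    have hins : ∀ B : Finset (Fin N), insert (X y) L ∪ X '' (B : Set (Fin N)) =
        L ∪ X '' ((insert y B : Finset (Fin N)) : Set (Fin N)) := fun B => by
      rw [Finset.coe_insert, Set.image_insert_eq, Set.insert_union, Set.union_insert]
    obtain ⟨h, hh, hxh⟩ := ihd L x (fun B hB => hx B hB.1) (fun B hB => hind B hB.1) _
      (dirDeriv_mem_transversalKer_deletion (y := y) hg)
    obtain ⟨f, hf, hyf⟩ := ihc L (X y)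
      (by rintro _ ⟨B, hB, hyB, rfl⟩; exact hind B hB y hyB)
      (by
        rintro _ ⟨B, hB, hyB, rfl⟩ b hb
        exact fun hmem => hind B hB b (Finset.mem_of_mem_erase hb)
          (hmono _ _ (Finset.erase_subset_erase _ (Finset.erase_subset _ _)) hmem))
      h (transversalKer_deletion_le_contraction hy hh)
    have hf𝔅 : f ∈ transversalKer X 𝔅 L := mem_transversalKer_of_dirDeriv_mem hf (hyf ▸ hh)
    have hrest : g - dirDeriv x f ∈ transversalKer X 𝔅 L :=
      sub_mem hg (dirDeriv_mem_transversalKer x hf𝔅)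
    have hker : dirDeriv (X y) (g - dirDeriv x f) = 0 := by
      rw [map_sub, dirDeriv_comm, hyf, hxh, sub_self]
    obtain ⟨f', hf', hxf'⟩ := ihc (insert (X y) L) x
      (by
        rintro _ ⟨B, hB, hyB, rfl⟩
        rw [hins, Finset.insert_erase hyB]
        exact hx B hB)
      (by
        rintro _ ⟨B, hB, hyB, rfl⟩ b hb
        rw [hins, Finset.erase_right_comm, Finset.insert_erase
          (Finset.mem_erase.2 ⟨(Finset.ne_of_mem_erase hb).symm, hyB⟩)]
        exact hind B hB b (Finset.mem_of_mem_erase hb))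
      (g - dirDeriv x f) (by
        have := mem_transversalKer.1 (transversalKer_le_contraction hy hrest)
        refine mem_transversalKer.2 ⟨this.1, ?_⟩
        rintro l (rfl | hl)
        exacts [hker, this.2 l hl])
    rw [mem_transversalKer] at hf'
    have hf'𝔅 : f' ∈ transversalKer X 𝔅 L := by
      refine mem_transversalKer_of_dirDeriv_mem (y := y) (mem_transversalKer.2
        ⟨hf'.1, fun l hl => hf'.2 l (Set.mem_insert_of_mem _ hl)⟩) ?_
      rw [hf'.2 _ (Set.mem_insert _ _)]
      exact zero_mem _
    exact ⟨f + f', add_mem hf𝔅 hf'𝔅, by rw [map_add, hxf', add_sub_cancel]⟩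

end Annihilators

section Exchange

variable {r N : ℕ} {X : Fin N → Fin r → ℝ} {𝔅 : Set (Finset (Fin N))}

lemma Decomposable.image_union (h : Decomposable 𝔅) (A : Finset (Fin N))
    (hA : ∀ B ∈ 𝔅, Disjoint A B) : Decomposable ((fun B => A ∪ B) '' 𝔅) := by
  induction A using Finset.induction_on with
  | empty => simpa using h
  | insert a A ha ih =>
    have hA' := fun B hB => Finset.disjoint_insert_left.1 (hA B hB)
    refine .shed a ?_ (.leaf ?_) ?_
    · rintro _ ⟨B, -, rfl⟩ haB
      simp at haB
    · rintro _ ⟨⟨B, -, rfl⟩, haB⟩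
      simp at haB
    · convert ih fun B hB => (hA' B hB).2 using 1
      have key : ∀ B ∈ 𝔅, (insert a A ∪ B).erase a = A ∪ B := fun B hB => by
        rw [Finset.insert_union, Finset.erase_insert (by simp [ha, (hA' B hB).1])]
      ext D
      constructor
      · rintro ⟨_, ⟨B, hB, rfl⟩, -, rfl⟩
        exact ⟨B, hB, (key B hB).symm⟩
      · rintro ⟨B, hB, rfl⟩
        exact ⟨_, ⟨B, hB, rfl⟩, by simp, (key B hB).symm⟩

/-- The flag spanned by the initial segments of `B` first contains a given nonzero vector of its
span at some `b ∈ B`. -/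
lemma exists_jump {B : Finset (Fin N)} {v : Fin r → ℝ} {n : ℕ} (hv : v ≠ 0)
    (hmem : v ∈ Submodule.span ℝ (X '' {e | e ∈ B ∧ (e : ℕ) < n})) :
    ∃ b ∈ B, (b : ℕ) < n ∧ v ∈ Submodule.span ℝ (X '' {e | e ∈ B ∧ e ≤ b}) ∧
      v ∉ Submodule.span ℝ (X '' {e | e ∈ B ∧ e < b}) := by
  induction n with
  | zero => simp [hv] at hmem
  | succ n ih =>
    by_cases h : v ∈ Submodule.span ℝ (X '' {e | e ∈ B ∧ (e : ℕ) < n})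
    · obtain ⟨b, hb, hbn, h'⟩ := ih h
      exact ⟨b, hb, hbn.trans (Nat.lt_succ_self n), h'⟩
    · have : ∃ b ∈ B, (b : ℕ) = n := by
        by_contra! hcon
        refine h (Submodule.span_mono (Set.image_mono ?_) hmem)
        exact fun e he => ⟨he.1, lt_of_le_of_ne (Nat.lt_succ_iff.1 he.2) (hcon e he.1)⟩
      obtain ⟨b, hb, rfl⟩ := this
      refine ⟨b, hb, Nat.lt_succ_self _, ?_, h⟩
      refine Submodule.span_mono (Set.image_mono ?_) hmem
      exact fun e he => ⟨he.1, Nat.lt_succ_iff.1 he.2⟩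

lemma basesOn.notMem_span_erase {G B : Finset (Fin N)} (hB : B ∈ basesOn X G) {b : Fin N}
    (hb : b ∈ B) :
    X b ∉ Submodule.span ℝ (X '' ((B.erase b : Finset (Fin N)) : Set (Fin N))) := by
  have h : LinearIndepOn ℝ X (B : Set (Fin N)) := hB.2.1
  simpa using linearIndepOn_iff_notMem_span.1 h b hb

lemma forwardExchange.exists_exchange (hfe : forwardExchange X 𝔅)
    (hsub : 𝔅 ⊆ basesOn X Finset.univ) {B : Finset (Fin N)} (hB : B ∈ 𝔅) {y : Fin N} (hy : y ∉ B)
    (hspan : X y ∉ Submodule.span ℝ (X '' {e | e ∈ B ∧ e < y})) :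
    ∃ b ∈ B, y < b ∧ insert y (B.erase b) ∈ 𝔅 := by
  have hle : {e | e ∈ B ∧ e ≤ y} = {e | e ∈ B ∧ e < y} := by
    ext e
    exact and_congr_right fun he => ⟨fun h => lt_of_le_of_ne h fun h' => hy (h' ▸ he), le_of_lt⟩
  obtain ⟨b, hb, -, h1, h2⟩ := exists_jump (X := X) (B := B) (n := N) (v := X y)
    (fun h => hspan (h ▸ zero_mem _)) (by
      have : {e | e ∈ B ∧ (e : ℕ) < N} = (B : Set (Fin N)) := by ext; simp
      rw [this, (hsub hB).2.2]
      trivial)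
  refine ⟨b, hb, ?_, hfe B hB b hb y h1 h2 fun h => hspan (hle ▸ h.2)⟩
  by_contra! hlt
  refine hspan (hle ▸ Submodule.span_mono (Set.image_mono ?_) h1)
  exact fun e he => ⟨he.1, he.2.trans hlt⟩

/-- The traces on `{k, k + 1, …}` of the members of `𝔅` with prescribed trace `A` on
`{0, …, k - 1}` can be decomposed by shedding the elements in increasing order. -/
lemma forwardExchange.decomposable (hfe : forwardExchange X 𝔅)
    (hsub : 𝔅 ⊆ basesOn X Finset.univ) (k : ℕ) (A : Finset (Fin N)) (hA : ∀ a ∈ A, (a : ℕ) < k) :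
    Decomposable {D | ∃ B ∈ 𝔅, B.filter (fun e : Fin N => (e : ℕ) < k) = A ∧
      D = B.filter (fun e : Fin N => k ≤ (e : ℕ))} := by
  by_cases hk : N ≤ k
  · refine .leaf ?_
    rintro _ ⟨B, -, -, rfl⟩
    simp only [Set.mem_singleton_iff, Finset.filter_eq_empty_iff]
    intro e _
    have := e.2
    omega
  push Not at hk
  set y : Fin N := ⟨k, hk⟩ with hy
  have hyk : (y : ℕ) = k := rfl
  have hcoe : ∀ e : Fin N, (e : ℕ) = k ↔ e = y := fun e => by rw [Fin.ext_iff]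
  have hyA : y ∉ A := fun h => absurd (hA y h) (by simp [hyk])
  have ih := forwardExchange.decomposable hfe hsub (k + 1) A fun a ha =>
    (hA a ha).trans_le (by simp)
  have hnot : ∀ B : Finset (Fin N), y ∉ B →
      B.filter (fun e : Fin N => (e : ℕ) < k + 1) = B.filter (fun e : Fin N => (e : ℕ) < k) ∧
      B.filter (fun e : Fin N => k + 1 ≤ (e : ℕ)) = B.filter (fun e : Fin N => k ≤ (e : ℕ)) :=
      fun B hB => by
    constructor <;> refine Finset.filter_congr fun e he => ?_ <;>
    · have : (e : ℕ) ≠ k := fun h => hB ((hcoe e).1 h ▸ he)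
      omega
  have hdel : ∀ B : Finset (Fin N), B.filter (fun e : Fin N => (e : ℕ) < k + 1) = A → y ∉ B :=
    fun B hBA hyB => hyA (hBA ▸ by simp [hyB, hyk])
  by_cases hspan : X y ∈ Submodule.span ℝ (X '' (A : Set (Fin N)))
  · convert ih using 1
    ext D
    constructor
    · rintro ⟨B, hB, hBA, rfl⟩
      have hyB : y ∉ B := fun hyB => basesOn.notMem_span_erase (hsub hB) hyB
        (Submodule.span_mono (Set.image_mono (by
          intro a ha
          have ha' := Finset.mem_coe.1 ha
          have hay : a ≠ y := fun h => hyA (h ▸ ha')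
          rw [← hBA, Finset.mem_filter] at ha'
          simp [ha'.1, hay])) hspan)
      exact ⟨B, hB, (hnot B hyB).1.trans hBA, (hnot B hyB).2.symm⟩
    · rintro ⟨B, hB, hBA, rfl⟩
      have hyB := hdel B hBA
      exact ⟨B, hB, (hnot B hyB).1 ▸ hBA, (hnot B hyB).2⟩
  refine .shed y ?_ ?_ ?_
  · rintro _ ⟨B, hB, hBA, rfl⟩ hyB
    replace hyB : y ∉ B := fun h => hyB (by simp [h, hyk])
    have hset : {e | e ∈ B ∧ e < y} = (A : Set (Fin N)) := by
      rw [← hBA]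
      ext e
      simp [Fin.lt_def, hyk]
    obtain ⟨b, hb, hyb, hB'⟩ := hfe.exists_exchange hsub hB hyB (hset ▸ hspan)
    rw [Fin.lt_def, hyk] at hyb
    refine ⟨_, ⟨_, hB', ?_, rfl⟩, by simp [hyk], ?_⟩
    · rw [← hBA]
      ext e
      simp only [Finset.mem_filter, Finset.mem_insert, Finset.mem_erase]
      constructor
      · rintro ⟨rfl | h, hek⟩
        · omega
        · exact ⟨h.2, hek⟩
      · rintro ⟨he, hek⟩
        exact ⟨Or.inr ⟨fun h => by subst h; omega, he⟩, hek⟩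
    · intro e he
      simp only [Finset.mem_filter, Finset.mem_insert, Finset.mem_erase] at he ⊢
      tauto
  · convert ih using 1
    ext D
    constructor
    · rintro ⟨⟨B, hB, hBA, rfl⟩, hyB⟩
      replace hyB : y ∉ B := fun h => hyB (by simp [h, hyk])
      exact ⟨B, hB, (hnot B hyB).1.trans hBA, (hnot B hyB).2.symm⟩
    · rintro ⟨B, hB, hBA, rfl⟩
      have hyB := hdel B hBA
      exact ⟨⟨B, hB, (hnot B hyB).1 ▸ hBA, (hnot B hyB).2⟩, by simp [hyk]⟩
  · convert forwardExchange.decomposable hfe hsub (k + 1) (insert y A) (by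
      intro a ha
      rcases Finset.mem_insert.1 ha with rfl | ha
      · omega
      · exact (hA a ha).trans (Nat.lt_succ_self k)) using 1
    have hlt : ∀ B : Finset (Fin N), y ∈ B → B.filter (fun e : Fin N => (e : ℕ) < k + 1) =
        insert y (B.filter (fun e : Fin N => (e : ℕ) < k)) := fun B hB => by
      ext e
      have := hcoe e
      simp only [Finset.mem_filter, Finset.mem_insert]
      constructor
      · rintro ⟨he, hek⟩
        by_cases h : e = y
        · exact Or.inl h
        · exact Or.inr ⟨he, by have := mt this.1 h; omega⟩
      · rintro (rfl | h)
        · exact ⟨hB, by omega⟩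
        · exact ⟨h.1, by omega⟩
    have hge : ∀ B : Finset (Fin N), (B.filter (fun e : Fin N => k ≤ (e : ℕ))).erase y =
        B.filter (fun e : Fin N => k + 1 ≤ (e : ℕ)) := fun B => by
      ext e
      have := hcoe e
      simp only [Finset.mem_filter, Finset.mem_erase, ne_eq, ← this]
      constructor
      · rintro ⟨h, he, hk⟩; exact ⟨he, by omega⟩
      · rintro ⟨he, hk⟩; exact ⟨by omega, he, by omega⟩
    ext D
    constructor
    · rintro ⟨_, ⟨B, hB, hBA, rfl⟩, hyB, rfl⟩
      exact ⟨B, hB, by rw [hlt B (Finset.mem_filter.1 hyB).1, hBA], hge B⟩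
    · rintro ⟨B, hB, hBA, rfl⟩
      have hyB : y ∈ B := (Finset.mem_filter.1 (hBA ▸ Finset.mem_insert_self y A)).1
      refine ⟨_, ⟨B, hB, ?_, rfl⟩, by simp [hyB, hyk], (hge B).symm⟩
      rw [hlt B hyB] at hBA
      have := congrArg (fun S => Finset.erase S y) hBA
      simpa [Finset.erase_insert, hyA, hyk] using this
termination_by N - k

variable {x : Fin N}

lemma notMem_span_lt_of_first (hsub : 𝔅 ⊆ basesOn X Finset.univ) (hx : X x ≠ 0)
    (hmin : ∀ j : Fin N, j < x → X j = 0 ∨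
      Submodule.span ℝ (X '' ((Finset.univ.erase j : Finset (Fin N)) : Set (Fin N))) ≠ ⊤)
    (hspan : Submodule.span ℝ (Set.range X) = ⊤) {B : Finset (Fin N)} (hB : B ∈ 𝔅) :
    X x ∉ Submodule.span ℝ (X '' {e | e ∈ B ∧ e < x}) := by
  intro hmem
  obtain ⟨b, hb, hbx, h1, h2⟩ := exists_jump (n := x) hx hmem
  have hset : {e | e ∈ B ∧ e ≤ b} = insert b {e | e ∈ B ∧ e < b} := by
    ext e
    simp only [Set.mem_ofPred_eq, Set.mem_insert_iff, le_iff_eq_or_lt]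
    constructor
    · tauto
    · rintro (rfl | h) <;> tauto
  rw [hset, Set.image_insert_eq] at h1
  have h3 := mem_span_insert_exchange h1 h2
  have h4 : X b ∈
      Submodule.span ℝ (X '' ((Finset.univ.erase b : Finset (Fin N)) : Set (Fin N))) := by
    rw [← Set.image_insert_eq] at h3
    refine Submodule.span_mono (Set.image_mono ?_) h3
    rintro e (rfl | he)
    · simpa [Fin.ext_iff] using (ne_of_lt hbx).symm
    · simpa using he.2.ne
  rcases hmin b hbx with h0 | h0
  · exact basesOn.notMem_span_erase (hsub hB) hb (h0 ▸ zero_mem _)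
  · refine h0 (top_le_iff.1 (hspan ▸ Submodule.span_le.2 ?_))
    rintro _ ⟨e, rfl⟩
    rcases eq_or_ne e b with rfl | he
    · exact h4
    · exact Submodule.subset_span ⟨e, by simpa using he, rfl⟩

lemma filter_lt_eq_of_first (hsub : 𝔅 ⊆ basesOn X Finset.univ)
    (hmin : ∀ j : Fin N, j < x → X j = 0 ∨
      Submodule.span ℝ (X '' ((Finset.univ.erase j : Finset (Fin N)) : Set (Fin N))) ≠ ⊤)
    {B : Finset (Fin N)} (hB : B ∈ 𝔅) :
    B.filter (fun e => e < x) = Finset.univ.filter (fun e => e < x ∧ X e ≠ 0) := by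
  ext e
  simp only [Finset.mem_filter, Finset.mem_univ, true_and]
  refine ⟨fun ⟨he, hex⟩ => ⟨hex, fun h0 => ?_⟩, fun ⟨hex, h0⟩ => ⟨?_, hex⟩⟩
  · exact basesOn.notMem_span_erase (hsub hB) he (h0 ▸ zero_mem _)
  · by_contra he
    refine ((hmin e hex).resolve_left h0) (top_le_iff.1 ((hsub hB).2.2 ▸ ?_))
    refine Submodule.span_mono (Set.image_mono fun a ha => ?_)
    have : a ≠ e := fun h => he (h ▸ ha)
    simpa using this

lemma forwardExchange.decomposable_contraction (hfe : forwardExchange X 𝔅)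
    (hsub : 𝔅 ⊆ basesOn X Finset.univ)
    (hmin : ∀ j : Fin N, j < x → X j = 0 ∨
      Submodule.span ℝ (X '' ((Finset.univ.erase j : Finset (Fin N)) : Set (Fin N))) ≠ ⊤) :
    Decomposable (contraction 𝔅 x) := by
  set A : Finset (Fin N) := Finset.univ.filter (fun e => e < x ∧ X e ≠ 0) with hA
  have hxA : x ∉ A := by simp [hA]
  have hAx : ∀ a ∈ A, a < x := fun a ha => by simp [hA] at ha; exact ha.1
  have hdec := hfe.decomposable hsub (x + 1) (insert x A) (by
    intro a ha
    rcases Finset.mem_insert.1 ha with rfl | ha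
    · exact Nat.lt_succ_self _
    · exact Nat.lt_succ_of_lt (hAx a ha))
  convert hdec.image_union A (by
    rintro _ ⟨B, -, -, rfl⟩
    rw [Finset.disjoint_left]
    intro a ha hab
    have h1 := Fin.lt_def.1 (hAx a ha)
    have h2 := (Finset.mem_filter.1 hab).2
    omega) using 1
  have hunion : ∀ B ∈ 𝔅, B.erase x = A ∪ B.filter (fun e : Fin N => (x : ℕ) + 1 ≤ (e : ℕ)) :=
      fun B hB => by
    rw [hA, ← filter_lt_eq_of_first hsub hmin hB]
    ext e
    simp only [Finset.mem_erase, Finset.mem_union, Finset.mem_filter, Fin.lt_def, ne_eq,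
      Fin.ext_iff]
    constructor
    · rintro ⟨h, he⟩
      rcases Nat.lt_or_gt_of_ne h with h | h
      exacts [Or.inl ⟨he, h⟩, Or.inr ⟨he, h⟩]
    · rintro (⟨he, h⟩ | ⟨he, h⟩)
      exacts [⟨by omega, he⟩, ⟨by omega, he⟩]
  ext D
  constructor
  · rintro ⟨B, hB, hxB, rfl⟩
    refine ⟨_, ⟨B, hB, ?_, rfl⟩, (hunion B hB).symm⟩
    rw [hA, ← filter_lt_eq_of_first hsub hmin hB]
    ext e
    simp only [Finset.mem_filter, Finset.mem_insert, Fin.lt_def, Nat.lt_succ_iff_lt_or_eq,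
      ← Fin.ext_iff]
    constructor
    · tauto
    · rintro (rfl | h) <;> tauto
  · rintro ⟨_, ⟨B, hB, hBA, rfl⟩, rfl⟩
    have hxB : x ∈ B := (Finset.mem_filter.1 (hBA ▸ Finset.mem_insert_self x A)).1
    exact ⟨B, hB, hxB, (hunion B hB).symm⟩

end Exchange

/-- deletion-contraction exact sequence
`0 → 𝒟(X/x, 𝔅'_{/x}) → 𝒟(X,𝔅') → 𝒟(X∖x, 𝔅'_{∖x}) → 0` for a forward exchange
set of bases `𝔅'` and `x` the first element of `X` that is neither a loop nor a
coloop (assuming restriction and deletion of `𝔅'` at `x` are both nonempty). -/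
theorem statement13 {r N : ℕ} (X : Fin N → Fin r → ℝ)
    (hX : Submodule.span ℝ (Set.range X) = ⊤)
    (𝔅' : Set (Finset (Fin N))) (hne : 𝔅'.Nonempty)
    (hsub : 𝔅' ⊆ basesOn X Finset.univ)
    (hfe : forwardExchange X 𝔅')
    (i0 : Fin N) (hloop : X i0 ≠ 0)
    (hcoloop : Submodule.span ℝ
      (X '' ((Finset.univ.erase i0 : Finset (Fin N)) : Set (Fin N))) = ⊤)
    (hmin : ∀ j : Fin N, j < i0 → X j = 0 ∨
      Submodule.span ℝ (X '' ((Finset.univ.erase j : Finset (Fin N)) : Set (Fin N))) ≠ ⊤)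
    (hdel : {B ∈ 𝔅' | i0 ∉ B}.Nonempty)
    (hres : {B ∈ 𝔅' | i0 ∈ B}.Nonempty) :
    (DspaceContrB X i0 𝔅' ≤ Dspace X Finset.univ 𝔅') ∧
    (∀ f ∈ Dspace X Finset.univ 𝔅',
      dirDeriv (X i0) f ∈ Dspace X (Finset.univ.erase i0) {B ∈ 𝔅' | i0 ∉ B}) ∧
    (∀ g ∈ Dspace X (Finset.univ.erase i0) {B ∈ 𝔅' | i0 ∉ B},
      ∃ f ∈ Dspace X Finset.univ 𝔅', dirDeriv (X i0) f = g) ∧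
    (Dspace X Finset.univ 𝔅' ⊓ LinearMap.ker (dirDeriv (X i0))
      = DspaceContrB X i0 𝔅') := by
  have hshed : IsShedding 𝔅' i0 := fun B hB hiB => by
    obtain ⟨b, hb, -, hB'⟩ := hfe.exists_exchange hsub hB hiB
      (notMem_span_lt_of_first hsub hloop hmin hX hB)
    refine ⟨_, hB', Finset.mem_insert_self _ _, fun e he => ?_⟩
    simp only [Finset.mem_erase, Finset.mem_insert] at he
    tauto
  have hfull : Dspace X Finset.univ 𝔅' = transversalKer X 𝔅' ∅ :=
    Dspace_eq_transversalKer fun B _ => Finset.subset_univ B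
  have hdelD : Dspace X (Finset.univ.erase i0) {B ∈ 𝔅' | i0 ∉ B} =
      transversalKer X (deletion 𝔅' i0) ∅ :=
    Dspace_eq_transversalKer fun B hB => Finset.subset_erase.2 ⟨Finset.subset_univ B, hB.2⟩
  have hconD : DspaceContrB X i0 𝔅' =
      transversalKer X (contraction 𝔅' i0) ∅ ⊓ LinearMap.ker (dirDeriv (X i0)) := by
    rw [DspaceContrB, Dspace_eq_transversalKer]
    · rfl
    · rintro _ ⟨B, -, -, rfl⟩
      exact Finset.erase_subset_erase _ (Finset.subset_univ B)
  have hcon_le : DspaceContrB X i0 𝔅' ≤ Dspace X Finset.univ 𝔅' := by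
    rw [hconD, hfull]
    rintro f ⟨hf, hker⟩
    refine mem_transversalKer_of_dirDeriv_mem hf ?_
    rw [LinearMap.mem_ker.1 hker]
    exact zero_mem _
  refine ⟨hcon_le, fun f hf => ?_, fun g hg => ?_, le_antisymm ?_ (le_inf hcon_le ?_)⟩
  · rw [hfull] at hf
    rw [hdelD]
    exact dirDeriv_mem_transversalKer_deletion hf
  · rw [hdelD] at hg
    rw [hfull]
    obtain ⟨f, hf, hfg⟩ := (hfe.decomposable_contraction hsub hmin).exists_dirDeriv_eq
      (X := X) ∅ (X i0)
      (by
        rintro _ ⟨B, hB, hiB, rfl⟩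
        simpa using basesOn.notMem_span_erase (hsub hB) hiB)
      (by
        rintro _ ⟨B, hB, hiB, rfl⟩ b hb hmem
        rw [Set.empty_union] at hmem
        exact basesOn.notMem_span_erase (hsub hB) (Finset.mem_of_mem_erase hb)
          (Submodule.span_mono (Set.image_mono (Finset.coe_subset.2
            (Finset.erase_subset_erase _ (Finset.erase_subset _ _)))) hmem))
      g (transversalKer_deletion_le_contraction hshed hg)
    exact ⟨f, mem_transversalKer_of_dirDeriv_mem hf (hfg ▸ hg), hfg⟩
  · rw [hconD, hfull]
    exact inf_le_inf_right _ (transversalKer_le_contraction hshed)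
  · rw [hconD]
    exact inf_le_right
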